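/- If p*_n(s) is supermultiplicative in (n,s) (p*_{n1}(s1)p*_{n2}(s2) ≤ p*_{n1+n2}(s1+s2)), bounded by K^n, with positivity range [A_n, B_n], A_n/n → A, B_n/n → B, A < B, then the free energy F*(f) = lim_n (1/n) log Σ_s p*_n(s)e^{fs} exists for all f and equals sup_{A<ε<B} (log D(ε) + fε), where log D(ε) = lim_n (1/n) log p*_n(⌊εn⌋). -/

import Mathlib

open Filter Topology Real Set Finset

lemma aux_pow (p : ℕ → ℕ → ℝ)
    (hnonneg : ∀ n s, 0 ≤ p n s)
    (hsuper : ∀ n1 n2 s1 s2, p n1 s1 * p n2 s2 ≤ p (n1 + n2) (s1 + s2))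
    (m s r t k : ℕ) : p m s ^ k * p r t ≤ p (k * m + r) (k * s + t) := by
  induction k with
  | zero => simp
  | succ k ih =>
    calc p m s ^ (k+1) * p r t = p m s * (p m s ^ k * p r t) := by ring
      _ ≤ p m s * p (k * m + r) (k * s + t) := mul_le_mul_of_nonneg_left ih (hnonneg _ _)
      _ ≤ p (m + (k * m + r)) (s + (k * s + t)) := hsuper _ _ _ _
      _ = _ := by congr 1 <;> ring

/-- interior points are eventually in the positivity range -/
lemma aux_pos (p : ℕ → ℕ → ℝ) (A B : ℝ) (Ak Bk : ℕ → ℕ)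
    (hrange : ∀ n s, 0 < p n s ↔ Ak n ≤ s ∧ s ≤ Bk n)
    (hA : Tendsto (fun n : ℕ => (Ak n : ℝ) / n) atTop (𝓝 A))
    (hB : Tendsto (fun n : ℕ => (Bk n : ℝ) / n) atTop (𝓝 B))
    (ε : ℝ) (hε : ε ∈ Set.Ioo A B) (c : ℝ) :
    ∃ R : ℕ, 0 < R ∧ ∀ r : ℕ, R ≤ r → ∀ t : ℕ, |(t : ℝ) - ε * r| ≤ c → 0 < p r t := by
  have hc : Tendsto (fun n : ℕ => c / (n : ℝ)) atTop (𝓝 0) :=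
    tendsto_const_div_atTop_nhds_zero_nat c
  have h1 := (hA.add hc).eventually (gt_mem_nhds (show A + 0 < ε by linarith [hε.1]))
  have h2 := (hB.sub hc).eventually (lt_mem_nhds (show ε < B - 0 by linarith [hε.2]))
  obtain ⟨R, hR⟩ := Filter.eventually_atTop.1 (h1.and h2)
  refine ⟨R + 1, by omega, fun r hr t ht => ?_⟩
  obtain ⟨g1, g2⟩ := hR r (by omega)
  have hr0 : (0 : ℝ) < r := by exact_mod_cast (by omega : 0 < r)
  rw [← add_div, div_lt_iff₀ hr0] at g1
  rw [← sub_div, lt_div_iff₀ hr0] at g2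
  obtain ⟨ha, hb⟩ := abs_le.1 ht
  rw [hrange]
  constructor
  · have : (Ak r : ℝ) ≤ t := by linarith
    exact_mod_cast this
  · have : (t : ℝ) ≤ Bk r := by linarith
    exact_mod_cast this

/-- any positive point has its ratio in `[A,B]` -/
lemma aux_mem (p : ℕ → ℕ → ℝ) (A B : ℝ) (Ak Bk : ℕ → ℕ)
    (hnonneg : ∀ n s, 0 ≤ p n s)
    (hrange : ∀ n s, 0 < p n s ↔ Ak n ≤ s ∧ s ≤ Bk n)
    (hsuper : ∀ n1 n2 s1 s2, p n1 s1 * p n2 s2 ≤ p (n1 + n2) (s1 + s2))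
    (hA : Tendsto (fun n : ℕ => (Ak n : ℝ) / n) atTop (𝓝 A))
    (hB : Tendsto (fun n : ℕ => (Bk n : ℝ) / n) atTop (𝓝 B))
    (m s : ℕ) (hm : 0 < m) (hp : 0 < p m s) : A ≤ (s : ℝ) / m ∧ (s : ℝ) / m ≤ B := by
  have hsub : Tendsto (fun k : ℕ => k * m + m) atTop atTop := by
    refine tendsto_atTop_mono (fun k => ?_) tendsto_id
    simp only [id]
    nlinarith
  have hpos : ∀ k : ℕ, 0 < p (k * m + m) (k * s + s) := fun k =>
    lt_of_lt_of_le (by positivity) (aux_pow p hnonneg hsuper m s m s k)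
  have hm0 : (0 : ℝ) < m := by exact_mod_cast hm
  constructor
  · refine le_of_tendsto (hA.comp hsub) (Eventually.of_forall fun k => ?_)
    have h := ((hrange _ _).1 (hpos k)).1
    have h' : (Ak (k * m + m) : ℝ) ≤ k * s + s := by exact_mod_cast h
    simp only [Function.comp]
    rw [div_le_div_iff₀ (by push_cast; positivity) hm0]
    push_cast
    nlinarith
  · refine ge_of_tendsto (hB.comp hsub) (Eventually.of_forall fun k => ?_)
    have h := ((hrange _ _).1 (hpos k)).2
    have h' : (k * s + s : ℝ) ≤ (Bk (k * m + m) : ℝ) := by exact_mod_cast h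
    simp only [Function.comp]
    rw [div_le_div_iff₀ hm0 (by push_cast; positivity)]
    push_cast
    nlinarith

/-- values obtained by mixing two points to density `ε` -/
def auxW (p : ℕ → ℕ → ℝ) (ε : ℝ) : Set ℝ :=
  {y | ∃ (m s M u : ℕ) (α β : ℝ), 0 ≤ α ∧ 0 ≤ β ∧ 0 < p m s ∧ 0 < p M u ∧
    α * m + β * M = 1 ∧ α * s + β * u = ε ∧
    y = α * Real.log (p m s) + β * Real.log (p M u)}

lemma aux_logle (p : ℕ → ℕ → ℝ) (K : ℝ)
    (hbound : ∀ n s, p n s ≤ K ^ n) (n s : ℕ) (h : 0 < p n s) :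
    Real.log (p n s) ≤ n * Real.log K := by
  have := Real.log_le_log h (hbound n s)
  rwa [Real.log_pow] at this

lemma auxW_le (p : ℕ → ℕ → ℝ) (K : ℝ)
    (hbound : ∀ n s, p n s ≤ K ^ n) (ε y : ℝ) (hy : y ∈ auxW p ε) : y ≤ Real.log K := by
  obtain ⟨m, s, M, u, α, β, hα, hβ, h1, h2, e1, e2, rfl⟩ := hy
  have g1 := mul_le_mul_of_nonneg_left (aux_logle p K hbound m s h1) hα
  have g2 := mul_le_mul_of_nonneg_left (aux_logle p K hbound M u h2) hβ
  calc _ ≤ α * (m * Real.log K) + β * (M * Real.log K) := add_le_add g1 g2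
    _ = (α * m + β * M) * Real.log K := by ring
    _ = _ := by rw [e1, one_mul]

lemma aux_lower (p : ℕ → ℕ → ℝ) (A B : ℝ) (Ak Bk : ℕ → ℕ)
    (hnonneg : ∀ n s, 0 ≤ p n s)
    (hrange : ∀ n s, 0 < p n s ↔ Ak n ≤ s ∧ s ≤ Bk n)
    (hsuper : ∀ n1 n2 s1 s2, p n1 s1 * p n2 s2 ≤ p (n1 + n2) (s1 + s2))
    (hA : Tendsto (fun n : ℕ => (Ak n : ℝ) / n) atTop (𝓝 A))
    (hB : Tendsto (fun n : ℕ => (Bk n : ℝ) / n) atTop (𝓝 B))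
    (ε : ℝ) (hε0 : 0 ≤ ε) (hε : ε ∈ Set.Ioo A B) (y : ℝ) (hy : y ∈ auxW p ε) :
    ∃ (D : ℝ) (R : ℕ), ∀ n : ℕ, R ≤ n → n * y - D ≤ Real.log (p n ⌊ε * n⌋₊) := by
  obtain ⟨m, s, M, u, α, β, hα, hβ, h1, h2, e1, e2, rfl⟩ := hy
  obtain ⟨R, hR0, hR⟩ := aux_pos p A B Ak Bk hrange hA hB ε hε (s + u + 1 + ε * (m + M))
  obtain ⟨c0, hc0⟩ : ∃ c0 : ℝ, ∀ r ≤ R + m + M, ∀ t ≤ ⌈ε * R⌉₊ + s + u,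
      c0 ≤ Real.log (p r t) := by
    obtain ⟨c0, h⟩ := ((Finset.range (R + m + M + 1) ×ˢ
      Finset.range (⌈ε * R⌉₊ + s + u + 1)).image
        (fun q : ℕ × ℕ => Real.log (p q.1 q.2))).bddBelow
    refine ⟨c0, fun r hr t ht => h (Finset.mem_coe.2 (Finset.mem_image.2 ⟨(r, t), ?_, rfl⟩))⟩
    simp only [Finset.mem_product, Finset.mem_range]
    omega
  set x := Real.log (p m s) with hx
  set z := Real.log (p M u) with hz
  refine ⟨R * (α * x + β * z) + |x| + |z| - c0, R, fun n hn => ?_⟩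
  have hn' : (0 : ℝ) ≤ (n : ℝ) - R := by
    have : (R : ℝ) ≤ n := by exact_mod_cast hn
    linarith
  obtain ⟨a, ha⟩ : ∃ a, a = ⌊α * ((n : ℝ) - R)⌋₊ := ⟨_, rfl⟩
  obtain ⟨b, hb⟩ : ∃ b, b = ⌊β * ((n : ℝ) - R)⌋₊ := ⟨_, rfl⟩
  have ha1 : (a : ℝ) ≤ α * ((n : ℝ) - R) := ha ▸ Nat.floor_le (by positivity)
  have hb1 : (b : ℝ) ≤ β * ((n : ℝ) - R) := hb ▸ Nat.floor_le (by positivity)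
  have ha2 : α * ((n : ℝ) - R) < a + 1 := ha ▸ Nat.lt_floor_add_one _
  have hb2 : β * ((n : ℝ) - R) < b + 1 := hb ▸ Nat.lt_floor_add_one _
  obtain ⟨t, ht⟩ : ∃ t, t = ⌊ε * (n : ℝ)⌋₊ := ⟨_, rfl⟩
  have ht1 : (t : ℝ) ≤ ε * n := ht ▸ Nat.floor_le (by positivity)
  have ht2 : ε * n < t + 1 := ht ▸ Nat.lt_floor_add_one _
  have L : ∀ i j : ℕ, (a : ℝ) * i + b * j ≤ (α * i + β * j) * ((n : ℝ) - R) := fun i j => by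
    have q1 := mul_le_mul_of_nonneg_right ha1 (Nat.cast_nonneg (α := ℝ) i)
    have q2 := mul_le_mul_of_nonneg_right hb1 (Nat.cast_nonneg (α := ℝ) j)
    linarith
  have U : ∀ i j : ℕ, (α * i + β * j) * ((n : ℝ) - R) ≤ (a : ℝ) * i + b * j + i + j :=
    fun i j => by
    have q1 := mul_le_mul_of_nonneg_right ha2.le (Nat.cast_nonneg (α := ℝ) i)
    have q2 := mul_le_mul_of_nonneg_right hb2.le (Nat.cast_nonneg (α := ℝ) j)
    linarith
  have L1 := L m M
  have L2 := L s u
  have U1 := U m M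
  have U2 := U s u
  rw [e1, one_mul] at L1 U1
  rw [e2] at L2 U2
  have hRε : 0 ≤ ε * R := by positivity
  have k1 : a * m + b * M + R ≤ n := by
    have : (a : ℝ) * m + b * M + R ≤ n := by linarith
    exact_mod_cast this
  have k2 : a * s + b * u ≤ t := by
    rw [ht]
    apply Nat.le_floor
    push_cast
    linarith
  obtain ⟨r, hr⟩ := Nat.exists_eq_add_of_le (show a * m + b * M ≤ n by omega)
  obtain ⟨t', ht'⟩ := Nat.exists_eq_add_of_le k2
  have hrR : (n : ℝ) = a * m + b * M + r := by exact_mod_cast hr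
  have htR : (t : ℝ) = a * s + b * u + t' := by exact_mod_cast ht'
  have r1 : (R : ℝ) ≤ r := by linarith
  have r2 : (r : ℝ) ≤ R + m + M := by linarith
  have t1 : ε * R - 1 ≤ (t' : ℝ) := by linarith
  have t2 : (t' : ℝ) ≤ ε * R + s + u := by linarith
  have er1 := mul_le_mul_of_nonneg_left r1 hε0
  have er2 := mul_le_mul_of_nonneg_left r2 hε0
  have hεm : 0 ≤ ε * (m + M) := by positivity
  have hsu : (0 : ℝ) ≤ s + u := by positivity
  have hpr : 0 < p r t' := hR r (by exact_mod_cast r1) t' (by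
    rw [abs_le]; constructor <;> linarith)
  have hc := hc0 r (by exact_mod_cast r2) t' (by
    have := Nat.le_ceil (ε * R)
    have : (t' : ℝ) ≤ ⌈ε * R⌉₊ + s + u := by linarith
    exact_mod_cast this)
  have hmain : p m s ^ a * (p M u ^ b * p r t') ≤ p n t := by
    have g1 := aux_pow p hnonneg hsuper M u r t' b
    have g2 := aux_pow p hnonneg hsuper m s (b * M + r) (b * u + t') a
    rw [hr, ht', add_assoc, add_assoc]
    exact (mul_le_mul_of_nonneg_left g1 (by positivity)).trans g2
  have hlog := Real.log_le_log (by positivity) hmain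
  rw [Real.log_mul (by positivity) (by positivity), Real.log_mul (by positivity) (by positivity),
    Real.log_pow, Real.log_pow, ← hx, ← hz] at hlog
  rw [← ht]
  have bd : ∀ (w v x : ℝ), w ≤ v → v ≤ w + 1 → v * x - |x| ≤ w * x := fun w v x p1 p2 => by
    nlinarith [le_abs_self x, neg_abs_le x, abs_nonneg x]
  have b1 := bd _ _ x ha1 ha2.le
  have b2 := bd _ _ z hb1 hb2.le
  linarith

/-- van Rensburg's Theorems 3.4–3.6/3.17–3.19 as used in the paper: for a
supermultiplicative, exponentially bounded array `p n s` with positivity range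
`[A_n, B_n]`, `A_n/n → A`, `B_n/n → B`, `A < B`, the density function
`logD ε = lim (1/n) log p_n(⌊εn⌋)` exists on `(A,B)`, the free energy
`F(f) = lim (1/n) log Σ_s p_n(s) e^{fs}` exists for all `f`, and
`F(f) = sup_{A<ε<B}(logD ε + fε)`. -/
theorem stmt_17 (p : ℕ → ℕ → ℝ) (K A B C : ℝ) (Ak Bk : ℕ → ℕ)
    (hK : 0 < K)
    (hnonneg : ∀ n s, 0 ≤ p n s)
    (hbound : ∀ n s, p n s ≤ K ^ n)
    (hrange : ∀ n s, 0 < p n s ↔ Ak n ≤ s ∧ s ≤ Bk n)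
    (hBk : ∀ n, (Bk n : ℝ) ≤ C * n)
    (hsuper : ∀ n1 n2 s1 s2, p n1 s1 * p n2 s2 ≤ p (n1 + n2) (s1 + s2))
    (hA : Tendsto (fun n : ℕ => (Ak n : ℝ) / n) atTop (𝓝 A))
    (hB : Tendsto (fun n : ℕ => (Bk n : ℝ) / n) atTop (𝓝 B))
    (hAB : A < B) :
    ∃ logD F : ℝ → ℝ,
      (∀ ε ∈ Set.Ioo A B,
        Tendsto (fun n : ℕ => Real.log (p n ⌊ε * n⌋₊) / n) atTop (𝓝 (logD ε))) ∧
      (∀ f : ℝ, Tendsto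
        (fun n : ℕ =>
          Real.log (∑ s ∈ Finset.Icc (Ak n) (Bk n), p n s * Real.exp (f * s)) / n)
        atTop (𝓝 (F f))) ∧
      (∀ f : ℝ, IsLUB ((fun ε => logD ε + f * ε) '' Set.Ioo A B) (F f)) := by
  have hA0 : 0 ≤ A := ge_of_tendsto hA (Eventually.of_forall fun n => by positivity)
  have hposE := aux_pos p A B Ak Bk hrange hA hB
  have hlow := aux_lower p A B Ak Bk hnonneg hrange hsuper hA hB
  have hbdd : ∀ ε, BddAbove (auxW p ε) := fun ε =>
    ⟨Real.log K, fun y hy => auxW_le p K hbound ε y hy⟩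
  have hfloor : ∀ ε : ℝ, 0 ≤ ε → ∀ n : ℕ, |((⌊ε * n⌋₊ : ℕ) : ℝ) - ε * n| ≤ 1 := fun ε h n => by
    have h1 := Nat.floor_le (show 0 ≤ ε * n by positivity)
    have h2 := Nat.lt_floor_add_one (ε * n)
    rw [abs_le]; constructor <;> linarith
  have hratio : ∀ ε : ℝ, 0 ≤ ε →
      Tendsto (fun n : ℕ => ((⌊ε * n⌋₊ : ℕ) : ℝ) / n) atTop (𝓝 ε) := fun ε h =>
    (tendsto_nat_floor_mul_div_atTop h).comp tendsto_natCast_atTop_atTop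
  -- mixing of two genuine points
  have hmix : ∀ (m s M u : ℕ) (l : ℝ), 0 < m → 0 < M → 0 < p m s → 0 < p M u → 0 ≤ l → l ≤ 1 →
      (1 - l) * (Real.log (p m s) / m) + l * (Real.log (p M u) / M) ∈
        auxW p ((1 - l) * ((s : ℝ) / m) + l * ((u : ℝ) / M)) := by
    intro m s M u l hm hM h1 h2 hl hl1
    have hm0 : (0 : ℝ) < m := by exact_mod_cast hm
    have hM0 : (0 : ℝ) < M := by exact_mod_cast hM
    refine ⟨m, s, M, u, (1 - l) / m, l / M, div_nonneg (by linarith) hm0.le, by positivity,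
      h1, h2, ?_, ?_, ?_⟩
    · field_simp; ring
    · ring
    · ring
  -- points in prescribed open subintervals
  have hpt : ∀ a b : ℝ, A ≤ a → a < b → b ≤ B → ∃ M u : ℕ, 0 < M ∧ 0 < p M u ∧
      a < (u : ℝ) / M ∧ (u : ℝ) / M < b := by
    intro a b ha hab hb
    obtain ⟨R, hR0, hR⟩ := hposE ((a + b) / 2) ⟨by linarith, by linarith⟩ 1
    have h1 := hratio ((a + b) / 2) (by linarith)
    have e1 := h1.eventually (lt_mem_nhds (show a < (a + b) / 2 by linarith))
    have e2 := h1.eventually (gt_mem_nhds (show (a + b) / 2 < b by linarith))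
    obtain ⟨n, ⟨q1, q2⟩, q3⟩ := ((e1.and e2).and (eventually_ge_atTop R)).exists
    exact ⟨n, _, by omega, hR n q3 _ (hfloor _ (by linarith) n), q1, q2⟩
  have hne : ∀ ε ∈ Set.Ioo A B, (auxW p ε).Nonempty := by
    intro ε hε
    obtain ⟨m, s, hm, hp, h1, h2⟩ := hpt A ε le_rfl hε.1 hε.2.le
    obtain ⟨M, u, hM, hq, g1, g2⟩ := hpt ε B hε.1.le hε.2 le_rfl
    have hd : 0 < (u : ℝ) / M - (s : ℝ) / m := by linarith
    have := hmix m s M u ((ε - (s : ℝ) / m) / ((u : ℝ) / M - (s : ℝ) / m)) hm hM hp hq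
      (div_nonneg (by linarith) hd.le) ((div_le_one hd).2 (by linarith))
    have key : ∀ v w : ℝ, 0 < w - v →
        (1 - (ε - v) / (w - v)) * v + (ε - v) / (w - v) * w = ε := by
      intro v w h
      have := h.ne'
      field_simp
      ring
    rw [key _ _ hd] at this
    exact ⟨_, this⟩
  have hlimlow : ∀ ε ∈ Set.Ioo A B, ∀ y < sSup (auxW p ε),
      ∀ᶠ n : ℕ in atTop, y < Real.log (p n ⌊ε * n⌋₊) / n := by
    intro ε hε y hy
    obtain ⟨w, hw, hyw⟩ := exists_lt_of_lt_csSup (hne ε hε) hy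
    obtain ⟨D, R, hDR⟩ := hlow ε (hA0.trans hε.1.le) hε w hw
    have hD : Tendsto (fun n : ℕ => w - D / (n : ℝ)) atTop (𝓝 (w - 0)) :=
      tendsto_const_nhds.sub (tendsto_const_div_atTop_nhds_zero_nat D)
    filter_upwards [hD.eventually (lt_mem_nhds (show y < w - 0 by linarith)),
      eventually_ge_atTop R, eventually_gt_atTop 0] with n q1 q2 q3
    have hn : (0 : ℝ) < n := by exact_mod_cast q3
    refine q1.trans_le ?_
    rw [le_div_iff₀ hn]
    have := hDR n q2
    have e : (w - D / n) * n = n * w - D := by field_simp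
    linarith
  have hlimD : ∀ ε ∈ Set.Ioo A B,
      Tendsto (fun n : ℕ => Real.log (p n ⌊ε * n⌋₊) / n) atTop (𝓝 (sSup (auxW p ε))) := by
    intro ε hε
    have hε0 : 0 ≤ ε := hA0.trans hε.1.le
    refine tendsto_order.2 ⟨fun y hy => hlimlow ε hε y hy, fun y hy => ?_⟩
    obtain ⟨M, u, hM, hq, g1, g2⟩ := hpt ε B hε.1.le hε.2 le_rfl
    obtain ⟨R, hR0, hR⟩ := hposE ε hε 1
    set v := (u : ℝ) / M with hv
    set z := Real.log (p M u) / M with hz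
    set V := sSup (auxW p ε) with hV
    have hl : Tendsto (fun n : ℕ => (ε - ((⌊ε * n⌋₊ : ℕ) : ℝ) / n) /
        (v - ((⌊ε * n⌋₊ : ℕ) : ℝ) / n)) atTop (𝓝 ((ε - ε) / (v - ε))) :=
      (tendsto_const_nhds.sub (hratio ε hε0)).div (tendsto_const_nhds.sub (hratio ε hε0))
        (by linarith)
    rw [sub_self, zero_div] at hl
    have hl2 := (tendsto_const_nhds (x := V)).sub (hl.mul_const z)
    have hl3 := hl2.div ((tendsto_const_nhds (x := (1 : ℝ))).sub hl) (by norm_num)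
    have hl4 := hl3.eventually (gt_mem_nhds (show (V - 0 * z) / (1 - 0) < y by simpa using hy))
    filter_upwards [hl4, eventually_ge_atTop R] with n q1 q2
    have hn0 : 0 < n := by omega
    have hn : (0 : ℝ) < n := by exact_mod_cast hn0
    refine lt_of_le_of_lt ?_ q1
    have hpn := hR n q2 _ (hfloor ε hε0 n)
    have hs : ((⌊ε * n⌋₊ : ℕ) : ℝ) / n ≤ ε := by
      rw [div_le_iff₀ hn]; exact Nat.floor_le (by positivity)
    simp only [Pi.div_apply]
    set w := ((⌊ε * n⌋₊ : ℕ) : ℝ) / n with hw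
    have hd : 0 < v - w := by linarith
    have hl1 : (ε - w) / (v - w) < 1 := (div_lt_one hd).2 (by linarith)
    have := hmix n _ M u ((ε - w) / (v - w)) hn0 hM hpn hq
      (div_nonneg (by linarith) hd.le) hl1.le
    rw [← hw, ← hv, ← hz] at this
    have key : (1 - (ε - w) / (v - w)) * w + (ε - w) / (v - w) * v = ε := by
      have := hd.ne'
      field_simp
      ring
    rw [key] at this
    have h3 := le_csSup (hbdd ε) this
    rw [le_div_iff₀ (by linarith)]
    linarith
  -- the Legendre transform
  have hGne : ∀ f : ℝ, ((fun ε => sSup (auxW p ε) + f * ε) '' Set.Ioo A B).Nonempty := fun f =>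
    (Set.nonempty_Ioo.2 hAB).image _
  have hGbdd : ∀ f : ℝ, BddAbove ((fun ε => sSup (auxW p ε) + f * ε) '' Set.Ioo A B) := by
    intro f
    refine ⟨Real.log K + |f| * B, ?_⟩
    rintro _ ⟨ε, hε, rfl⟩
    have h1 : sSup (auxW p ε) ≤ Real.log K :=
      csSup_le (hne ε hε) fun y hy => auxW_le p K hbound ε y hy
    have h2 : f * ε ≤ |f| * B :=
      (mul_le_mul_of_nonneg_right (le_abs_self f) (hA0.trans hε.1.le)).trans
        (mul_le_mul_of_nonneg_left hε.2.le (abs_nonneg f))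
    exact add_le_add h1 h2
  refine ⟨fun ε => sSup (auxW p ε),
    fun f => sSup ((fun ε => sSup (auxW p ε) + f * ε) '' Set.Ioo A B), hlimD, ?_,
    fun f => isLUB_csSup (hGne f) (hGbdd f)⟩
  intro f
  set F := sSup ((fun ε => sSup (auxW p ε) + f * ε) '' Set.Ioo A B) with hF
  -- every point lies below F
  have hup : ∀ n s : ℕ, 0 < n → 0 < p n s → Real.log (p n s) + f * s ≤ n * F := by
    intro n s hn hp
    obtain ⟨M, u, hM, hq, g1, g2⟩ := hpt A B le_rfl hAB le_rfl
    obtain ⟨b1, b2⟩ := aux_mem p A B Ak Bk hnonneg hrange hsuper hA hB n s hn hp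
    have hn0 : (0 : ℝ) < n := by exact_mod_cast hn
    set x := (s : ℝ) / n with hx
    set v := (u : ℝ) / M with hv
    set y := Real.log (p n s) / n with hy
    set z := Real.log (p M u) / M with hz
    have hl : ∀ l : ℝ, 0 < l → l < 1 → (1 - l) * (y + f * x) + l * (z + f * v) ≤ F := by
      intro l l0 l1
      have h1 := hmix n s M u l hn hM hp hq l0.le l1.le
      have h2 := le_csSup (hbdd _) h1
      have h3 : (1 - l) * x + l * v ∈ Set.Ioo A B := by
        constructor <;> nlinarith
      have h4 := le_csSup (hGbdd f) (Set.mem_image_of_mem _ h3)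
      simp only [← hF] at h4
      simp only [← hx, ← hv, ← hy, ← hz] at h2
      linarith
    have hc : Tendsto (fun l : ℝ => (1 - l) * (y + f * x) + l * (z + f * v)) (𝓝[>] 0)
        (𝓝 ((1 - 0) * (y + f * x) + 0 * (z + f * v))) := by
      refine Tendsto.mono_left (Continuous.tendsto ?_ 0) nhdsWithin_le_nhds
      fun_prop
    have h5 : (1 - 0) * (y + f * x) + 0 * (z + f * v) ≤ F := by
      refine le_of_tendsto hc ?_
      filter_upwards [Ioo_mem_nhdsGT (show (0 : ℝ) < 1 by norm_num)] with l h
      exact hl l h.1 h.2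
    have h6 : n * (y + f * x) ≤ n * F := by
      apply mul_le_mul_of_nonneg_left _ hn0.le
      linarith
    have h7 : n * (y + f * x) = Real.log (p n s) + f * s := by
      rw [hx, hy]; field_simp
    linarith
  refine tendsto_order.2 ⟨fun y hy => ?_, fun y hy => ?_⟩
  · obtain ⟨_, ⟨ε, hε, rfl⟩, hlt⟩ := exists_lt_of_lt_csSup (hGne f) hy
    have hε0 : 0 ≤ ε := hA0.trans hε.1.le
    obtain ⟨R, hR0, hR⟩ := hposE ε hε 1
    have h1 := (hlimD ε hε).add ((hratio ε hε0).const_mul f)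
    filter_upwards [h1.eventually (lt_mem_nhds hlt), eventually_ge_atTop R] with n q1 q2
    have hn0 : 0 < n := by omega
    have hn : (0 : ℝ) < n := by exact_mod_cast hn0
    have hpn := hR n q2 _ (hfloor ε hε0 n)
    refine q1.trans_le ?_
    rw [mul_div_assoc', ← add_div]
    apply div_le_div_of_nonneg_right _ hn.le
    rw [← Real.log_exp (f * _), ← Real.log_mul hpn.ne' (Real.exp_pos _).ne']
    apply Real.log_le_log (by positivity)
    exact Finset.single_le_sum (f := fun s : ℕ => p n s * Real.exp (f * s))
      (fun s _ => mul_nonneg (hnonneg _ _) (Real.exp_pos _).le)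
      (Finset.mem_Icc.2 ((hrange _ _).1 hpn))
  · have hlogn : Tendsto (fun n : ℕ => Real.log (n : ℝ) / n) atTop (𝓝 0) :=
      (Real.isLittleO_log_id_atTop.tendsto_div_nhds_zero).comp tendsto_natCast_atTop_atTop
    have hlim := ((tendsto_const_nhds (x := F)).add
      (tendsto_const_div_atTop_nhds_zero_nat (Real.log (|C| + 1)))).add hlogn
    obtain ⟨R, hR0, hR⟩ := hposE ((A + B) / 2) ⟨by linarith, by linarith⟩ 1
    filter_upwards [hlim.eventually (gt_mem_nhds (show F + 0 + 0 < y by linarith)),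
      eventually_ge_atTop R] with n q1 q2
    have hn0 : 0 < n := by omega
    have hn : (0 : ℝ) < n := by exact_mod_cast hn0
    have hn1 : (1 : ℝ) ≤ n := by exact_mod_cast hn0
    have hpn := hR n q2 _ (hfloor ((A + B) / 2) (by linarith) n)
    refine lt_of_le_of_lt ?_ q1
    have hterm : ∀ s ∈ Finset.Icc (Ak n) (Bk n), p n s * Real.exp (f * s) ≤ Real.exp (n * F) := by
      intro s hs
      have hp := (hrange n s).2 (Finset.mem_Icc.1 hs)
      rw [← Real.exp_log hp, ← Real.exp_add]
      exact Real.exp_le_exp.2 (hup n s hn0 hp)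
    have hsum := Finset.sum_le_card_nsmul _ _ _ hterm
    rw [nsmul_eq_mul, Nat.card_Icc] at hsum
    have hcard : ((Bk n + 1 - Ak n : ℕ) : ℝ) ≤ (|C| + 1) * n := by
      have h1 : ((Bk n + 1 - Ak n : ℕ) : ℝ) ≤ Bk n + 1 := by
        exact_mod_cast Nat.sub_le _ _
      have h2 := hBk n
      have h3 := mul_le_mul_of_nonneg_right (le_abs_self C) hn.le
      linarith
    have hsum2 := hsum.trans (mul_le_mul_of_nonneg_right hcard (Real.exp_pos _).le)
    have hZpos : 0 < ∑ s ∈ Finset.Icc (Ak n) (Bk n), p n s * Real.exp (f * s) :=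
      Finset.sum_pos (fun s hs =>
        mul_pos ((hrange n s).2 (Finset.mem_Icc.1 hs)) (Real.exp_pos _))
        ⟨_, Finset.mem_Icc.2 ((hrange _ _).1 hpn)⟩
    have hlog := Real.log_le_log hZpos hsum2
    have hC : 0 < |C| + 1 := by positivity
    rw [Real.log_mul (by positivity) (by positivity), Real.log_mul hC.ne' hn.ne',
      Real.log_exp] at hlog
    rw [div_le_iff₀ hn]
    have e : (F + Real.log (|C| + 1) / n + Real.log n / n) * n =
        n * F + Real.log (|C| + 1) + Real.log n := by field_simp
    linarith
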